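/- Let K := GL₂(ℤ_ℓ), t := diag(1,ℓ) ∈ GL₂(ℚ_ℓ), and K₁(ℓ) := {k ∈ K : k₂₁ ≡ 0 mod ℓ, k₂₂ ≡ 1 mod ℓ}. The map (t·K·t⁻¹ ∩ K)/(t·K₁(ℓ)·t⁻¹ ∩ K₁(ℓ)) → (t·K·t⁻¹)/(t·K₁(ℓ)·t⁻¹) induced by the inclusion is injective but not surjective, and the left cosets of t·K₁(ℓ)·t⁻¹ in t·K·t⁻¹ which do not meet t·K·t⁻¹ ∩ K are exactly the ℓ−1 pairwise distinct cosets t·(0,ũ;1,0)·t⁻¹·(t·K₁(ℓ)·t⁻¹) for u ∈ (ℤ/ℓℤ)ˣ, where ũ ∈ ℤ_ℓˣ is any lift of u (the coset being independent of the lift). -/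

import Mathlib

/- STATEMENT 11: the map (tKt⁻¹ ∩ K)/(tK₁(ℓ)t⁻¹ ∩ K₁(ℓ)) → (tKt⁻¹)/(tK₁(ℓ)t⁻¹)
   is injective but not surjective, and the missing cosets are exactly
   t·(0,ũ;1,0)·t⁻¹ · (tK₁(ℓ)t⁻¹) for u ∈ (ℤ/ℓℤ)ˣ. -/

open Matrix

noncomputable section

variable (ℓ : ℕ) [Fact ℓ.Prime]

/-- `g` has all entries in `ℤ_ℓ` and so does its inverse, i.e. `g ∈ GL₂(ℤ_ℓ)`. -/
def IsIntegralGL (g : GL (Fin 2) ℚ_[ℓ]) : Prop :=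
  (∀ i j, ‖(g : Matrix (Fin 2) (Fin 2) ℚ_[ℓ]) i j‖ ≤ 1) ∧
    (∀ i j, ‖((g⁻¹ : GL (Fin 2) ℚ_[ℓ]) : Matrix (Fin 2) (Fin 2) ℚ_[ℓ]) i j‖ ≤ 1)

lemma ell_ne_zero : ((ℓ : ℚ_[ℓ])) ≠ 0 :=
  Nat.cast_ne_zero.mpr (Fact.out (p := ℓ.Prime)).ne_zero

/-- The element `t = diag(1, ℓ)` of `GL₂(ℚ_ℓ)`. -/
def tGL : GL (Fin 2) ℚ_[ℓ] where
  val := !![1, 0; 0, (ℓ : ℚ_[ℓ])]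
  inv := !![1, 0; 0, (ℓ : ℚ_[ℓ])⁻¹]
  val_inv := by
    ext i j
    fin_cases i <;> fin_cases j <;>
      simp [Matrix.mul_apply, Fin.sum_univ_two, mul_inv_cancel₀ (ell_ne_zero ℓ)]
  inv_val := by
    ext i j
    fin_cases i <;> fin_cases j <;>
      simp [Matrix.mul_apply, Fin.sum_univ_two, inv_mul_cancel₀ (ell_ne_zero ℓ)]


/-- Membership in `K = GL₂(ℤ_ℓ)`. -/
def Kmem (g : GL (Fin 2) ℚ_[ℓ]) : Prop := IsIntegralGL ℓ g

/-- Membership in `K₁(ℓ)`. -/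
def K1mem (g : GL (Fin 2) ℚ_[ℓ]) : Prop :=
  IsIntegralGL ℓ g ∧
    ‖(g : Matrix (Fin 2) (Fin 2) ℚ_[ℓ]) 1 0‖ ≤ (ℓ : ℝ)⁻¹ ∧
    ‖(g : Matrix (Fin 2) (Fin 2) ℚ_[ℓ]) 1 1 - 1‖ ≤ (ℓ : ℝ)⁻¹

/-- Membership in `t · K · t⁻¹`. -/
def tKmem (g : GL (Fin 2) ℚ_[ℓ]) : Prop := Kmem ℓ ((tGL ℓ)⁻¹ * g * tGL ℓ)

/-- Membership in `t · K₁(ℓ) · t⁻¹`. -/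
def tK1mem (g : GL (Fin 2) ℚ_[ℓ]) : Prop := K1mem ℓ ((tGL ℓ)⁻¹ * g * tGL ℓ)

section NormEstimates

variable {ℓ}

lemma norm_le_inv_iff_lt_one (x : ℚ_[ℓ]) : ‖x‖ ≤ (ℓ : ℝ)⁻¹ ↔ ‖x‖ < 1 := by
  simpa using Padic.norm_le_pow_iff_norm_lt_pow_add_one x (-1)

lemma norm_mul_le_one {a b : ℚ_[ℓ]} (ha : ‖a‖ ≤ 1) (hb : ‖b‖ ≤ 1) : ‖a * b‖ ≤ 1 := by
  rw [norm_mul]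
  exact mul_le_one₀ ha (norm_nonneg _) hb

lemma norm_mul_lt_one_left {a b : ℚ_[ℓ]} (ha : ‖a‖ < 1) (hb : ‖b‖ ≤ 1) : ‖a * b‖ < 1 := by
  rw [norm_mul]
  exact mul_lt_one_of_nonneg_of_lt_one_left (norm_nonneg _) ha hb

lemma norm_mul_lt_one_right {a b : ℚ_[ℓ]} (ha : ‖a‖ ≤ 1) (hb : ‖b‖ < 1) : ‖a * b‖ < 1 := by
  rw [mul_comm]
  exact norm_mul_lt_one_left hb ha

lemma norm_add_le_one {a b : ℚ_[ℓ]} (ha : ‖a‖ ≤ 1) (hb : ‖b‖ ≤ 1) : ‖a + b‖ ≤ 1 :=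
  (Padic.nonarchimedean a b).trans (max_le ha hb)

lemma norm_add_lt_one {a b : ℚ_[ℓ]} (ha : ‖a‖ < 1) (hb : ‖b‖ < 1) : ‖a + b‖ < 1 :=
  (Padic.nonarchimedean a b).trans_lt (max_lt ha hb)

lemma norm_sub_le_one {a b : ℚ_[ℓ]} (ha : ‖a‖ ≤ 1) (hb : ‖b‖ ≤ 1) : ‖a - b‖ ≤ 1 := by
  rw [sub_eq_add_neg]
  exact norm_add_le_one ha (by rwa [norm_neg])

lemma norm_sub_lt_one {a b : ℚ_[ℓ]} (ha : ‖a‖ < 1) (hb : ‖b‖ < 1) : ‖a - b‖ < 1 := by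
  rw [sub_eq_add_neg]
  exact norm_add_lt_one ha (by rwa [norm_neg])

lemma norm_eq_one_of_norm_mul_sub_eq_one {a d e : ℚ_[ℓ]} (ha : ‖a‖ ≤ 1) (hd : ‖d‖ ≤ 1)
    (he : ‖e‖ < 1) (h : ‖a * d - e‖ = 1) : ‖a‖ = 1 := by
  by_contra hne
  exact (norm_sub_lt_one (norm_mul_lt_one_left (lt_of_le_of_ne ha hne) hd) he).ne h

end NormEstimates

section Integrality

variable {ℓ}

lemma isIntegralGL_iff_det (g : GL (Fin 2) ℚ_[ℓ]) :
    IsIntegralGL ℓ g ↔ (∀ i j, ‖g i j‖ ≤ 1) ∧ ‖g 0 0 * g 1 1 - g 0 1 * g 1 0‖ = 1 := by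
  have hdet : ∀ k : GL (Fin 2) ℚ_[ℓ], (∀ i j, ‖k i j‖ ≤ 1) → ‖(k : Matrix (Fin 2) (Fin 2) ℚ_[ℓ]).det‖ ≤ 1 := by
    intro k hk
    rw [Matrix.det_fin_two]
    exact norm_sub_le_one (norm_mul_le_one (hk _ _) (hk _ _)) (norm_mul_le_one (hk _ _) (hk _ _))
  rw [← Matrix.det_fin_two]
  constructor
  · rintro ⟨h1, h2⟩
    refine ⟨h1, ?_⟩
    have h : ‖(g : Matrix (Fin 2) (Fin 2) ℚ_[ℓ]).det‖ *
        ‖((g⁻¹ : GL (Fin 2) ℚ_[ℓ]) : Matrix (Fin 2) (Fin 2) ℚ_[ℓ]).det‖ = 1 := by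
      rw [← norm_mul, ← Matrix.det_mul, ← Units.val_mul, mul_inv_cancel]
      simp
    have := hdet g h1
    have := hdet g⁻¹ h2
    nlinarith [norm_nonneg (g : Matrix (Fin 2) (Fin 2) ℚ_[ℓ]).det]
  · rintro ⟨h1, h2⟩
    refine ⟨h1, fun i j => ?_⟩
    rw [Matrix.coe_units_inv, Matrix.inv_def, Ring.inverse_eq_inv', Matrix.smul_apply, smul_eq_mul,
      norm_mul, norm_inv, h2, inv_one, one_mul, Matrix.adjugate_fin_two]
    fin_cases i <;> fin_cases j <;> simp [h1]

lemma IsIntegralGL.inv {g : GL (Fin 2) ℚ_[ℓ]} (hg : IsIntegralGL ℓ g) : IsIntegralGL ℓ g⁻¹ :=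
  ⟨hg.2, by simpa using hg.1⟩

lemma IsIntegralGL.mul {g h : GL (Fin 2) ℚ_[ℓ]} (hg : IsIntegralGL ℓ g) (hh : IsIntegralGL ℓ h) :
    IsIntegralGL ℓ (g * h) := by
  have entries : ∀ a b : Matrix (Fin 2) (Fin 2) ℚ_[ℓ], (∀ i j, ‖a i j‖ ≤ 1) →
      (∀ i j, ‖b i j‖ ≤ 1) → ∀ i j, ‖(a * b) i j‖ ≤ 1 := by
    intro a b ha hb i j
    rw [Matrix.mul_apply, Fin.sum_univ_two]
    exact norm_add_le_one (norm_mul_le_one (ha _ _) (hb _ _)) (norm_mul_le_one (ha _ _) (hb _ _))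
  refine ⟨entries _ _ hg.1 hh.1, ?_⟩
  rw [_root_.mul_inv_rev]
  exact entries _ _ hh.2 hg.2

lemma K1mem_iff (g : GL (Fin 2) ℚ_[ℓ]) :
    K1mem ℓ g ↔ IsIntegralGL ℓ g ∧ ‖g 1 0‖ < 1 ∧ ‖g 1 1 - 1‖ < 1 := by
  rw [K1mem, norm_le_inv_iff_lt_one, norm_le_inv_iff_lt_one]

lemma K1mem.norm_apply_zero_zero {k : GL (Fin 2) ℚ_[ℓ]} (hk : K1mem ℓ k) : ‖k 0 0‖ = 1 := by
  obtain ⟨hi, h10, -⟩ := (K1mem_iff k).1 hk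
  obtain ⟨he, hd⟩ := (isIntegralGL_iff_det k).1 hi
  exact norm_eq_one_of_norm_mul_sub_eq_one (he _ _) (he _ _)
    (norm_mul_lt_one_right (he _ _) h10) hd

lemma tGL_conj_val (g : GL (Fin 2) ℚ_[ℓ]) :
    ((tGL ℓ * g * (tGL ℓ)⁻¹ : GL (Fin 2) ℚ_[ℓ]) : Matrix (Fin 2) (Fin 2) ℚ_[ℓ]) =
      !![g 0 0, g 0 1 * (ℓ : ℚ_[ℓ])⁻¹; ℓ * g 1 0, g 1 1] := by
  have h : (((tGL ℓ)⁻¹ : GL (Fin 2) ℚ_[ℓ]) : Matrix (Fin 2) (Fin 2) ℚ_[ℓ]) =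
      !![1, 0; 0, (ℓ : ℚ_[ℓ])⁻¹] := rfl
  have h' : ((tGL ℓ : GL (Fin 2) ℚ_[ℓ]) : Matrix (Fin 2) (Fin 2) ℚ_[ℓ]) =
      !![1, 0; 0, (ℓ : ℚ_[ℓ])] := rfl
  rw [Units.val_mul, Units.val_mul, h, h', Matrix.eta_fin_two (g : Matrix (Fin 2) (Fin 2) ℚ_[ℓ]),
    Matrix.mul_fin_two, Matrix.mul_fin_two]
  simp [mul_right_comm, ell_ne_zero ℓ]

lemma tGL_conj_mem_K_iff (g : GL (Fin 2) ℚ_[ℓ]) (hg : IsIntegralGL ℓ g) :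
    Kmem ℓ (tGL ℓ * g * (tGL ℓ)⁻¹) ↔ ‖g 0 1‖ < 1 := by
  have hℓ := ell_ne_zero ℓ
  have hpos : (0 : ℝ) < ℓ := Nat.cast_pos.2 (Fact.out (p := ℓ.Prime)).pos
  have hentry : ‖g 0 1 * (ℓ : ℚ_[ℓ])⁻¹‖ ≤ 1 ↔ ‖g 0 1‖ < 1 := by
    rw [← norm_le_inv_iff_lt_one, norm_mul, norm_inv, Padic.norm_p, inv_inv,
      ← le_div_iff₀ hpos, one_div]
  obtain ⟨he, hd⟩ := (isIntegralGL_iff_det g).1 hg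
  rw [Kmem, isIntegralGL_iff_det, tGL_conj_val]
  constructor
  · rintro ⟨h, -⟩
    exact hentry.1 (h 0 1)
  · intro h
    refine ⟨fun i j => ?_, ?_⟩
    · fin_cases i <;> fin_cases j
      · exact he 0 0
      · exact hentry.2 h
      · exact norm_mul_le_one (Padic.norm_p_lt_one.le) (he 1 0)
      · exact he 1 1
    · rw [← hd]
      congr 1
      simp
      field_simp

lemma tGL_conj_mem_tK_iff (g : GL (Fin 2) ℚ_[ℓ]) :
    tKmem ℓ (tGL ℓ * g * (tGL ℓ)⁻¹) ↔ IsIntegralGL ℓ g := by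
  rw [tKmem, Kmem]
  congr! 1
  group

lemma tGL_conj_inv_mul_mem_tK1_iff (g h : GL (Fin 2) ℚ_[ℓ]) :
    tK1mem ℓ ((tGL ℓ * g * (tGL ℓ)⁻¹)⁻¹ * (tGL ℓ * h * (tGL ℓ)⁻¹)) ↔ K1mem ℓ (g⁻¹ * h) := by
  rw [tK1mem]
  congr! 1
  group

lemma exists_eq_tGL_conj (x : GL (Fin 2) ℚ_[ℓ]) : ∃ g, x = tGL ℓ * g * (tGL ℓ)⁻¹ :=
  ⟨(tGL ℓ)⁻¹ * x * tGL ℓ, by group⟩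

end Integrality

section Cosets

variable {ℓ}

lemma K1mem_tGL_conj {k : GL (Fin 2) ℚ_[ℓ]} (hk : K1mem ℓ k)
    (hK : Kmem ℓ (tGL ℓ * k * (tGL ℓ)⁻¹)) : K1mem ℓ (tGL ℓ * k * (tGL ℓ)⁻¹) := by
  obtain ⟨hi, h10, h11⟩ := (K1mem_iff k).1 hk
  refine (K1mem_iff _).2 ⟨hK, ?_, ?_⟩
  · rw [tGL_conj_val]
    exact norm_mul_lt_one_right Padic.norm_p_lt_one.le h10
  · rw [tGL_conj_val]
    exact h11

/-- A coset `g K₁(ℓ)` contains an element with upper right entry divisible by `ℓ` unless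
the upper left entry of `g` is divisible by `ℓ`. -/
lemma exists_K1mem_inv_mul {g : GL (Fin 2) ℚ_[ℓ]} (hg : IsIntegralGL ℓ g) (h00 : ‖g 0 0‖ = 1) :
    ∃ h : GL (Fin 2) ℚ_[ℓ], IsIntegralGL ℓ h ∧ ‖h 0 1‖ < 1 ∧ K1mem ℓ (h⁻¹ * g) := by
  have hne : g 0 0 ≠ 0 := norm_ne_zero_iff.1 (by rw [h00]; exact one_ne_zero)
  have hq : ‖g 0 1 / g 0 0‖ ≤ 1 := by
    rw [norm_div, h00, div_one]
    exact hg.1 0 1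
  let k : GL (Fin 2) ℚ_[ℓ] :=
    Matrix.GeneralLinearGroup.mkOfDetNeZero !![1, g 0 1 / g 0 0; 0, 1] (by simp)
  have hkval : (k : Matrix (Fin 2) (Fin 2) ℚ_[ℓ]) = !![1, g 0 1 / g 0 0; 0, 1] := rfl
  have hkint : IsIntegralGL ℓ k := by
    rw [isIntegralGL_iff_det, hkval]
    refine ⟨fun i j => ?_, by simp⟩
    fin_cases i <;> fin_cases j <;> simp [-norm_div, hq]
  refine ⟨g * k⁻¹, hg.mul hkint.inv, ?_, ?_⟩
  · have : (g * k⁻¹) 0 1 = 0 := by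
      rw [Units.val_mul, Matrix.coe_units_inv, hkval, Matrix.inv_def, Matrix.adjugate_fin_two,
        Matrix.mul_apply]
      simp
      field_simp
      ring
    simp [this]
  · rw [show (g * k⁻¹)⁻¹ * g = k by group, K1mem_iff]
    exact ⟨hkint, by simp [hkval], by simp [hkval]⟩

lemma antidiagonal_inv_mul_val {w : ℚ_[ℓ]} (hw : w ≠ 0) {m : GL (Fin 2) ℚ_[ℓ]}
    (hm : (m : Matrix (Fin 2) (Fin 2) ℚ_[ℓ]) = !![0, w; 1, 0]) (g : GL (Fin 2) ℚ_[ℓ]) :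
    ((m⁻¹ * g : GL (Fin 2) ℚ_[ℓ]) : Matrix (Fin 2) (Fin 2) ℚ_[ℓ]) =
      !![g 1 0, g 1 1; g 0 0 / w, g 0 1 / w] := by
  rw [Units.val_mul, Matrix.coe_units_inv, hm, Matrix.inv_def, Matrix.adjugate_fin_two]
  ext i j
  fin_cases i <;> fin_cases j <;>
    simp [Matrix.mul_apply, Fin.sum_univ_two, Matrix.det_fin_two] <;> field_simp

lemma isIntegralGL_antidiagonal {w : ℚ_[ℓ]} (hw : ‖w‖ = 1) {m : GL (Fin 2) ℚ_[ℓ]}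
    (hm : (m : Matrix (Fin 2) (Fin 2) ℚ_[ℓ]) = !![0, w; 1, 0]) : IsIntegralGL ℓ m := by
  rw [isIntegralGL_iff_det, hm]
  refine ⟨fun i j => ?_, by simp [hw]⟩
  fin_cases i <;> fin_cases j <;> simp [hw]

lemma not_K1mem_inv_mul_of_norm_lt_one {g h : GL (Fin 2) ℚ_[ℓ]} (hg : ‖g 0 0‖ < 1)
    (hh : IsIntegralGL ℓ h) (h01 : ‖h 0 1‖ < 1) : ¬ K1mem ℓ (h⁻¹ * g) := by
  intro hk
  have hk00 := hk.norm_apply_zero_zero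
  have hki := hk.1.1
  obtain ⟨he, hd⟩ := (isIntegralGL_iff_det h).1 hh
  have h00 : ‖h 0 0‖ = 1 := norm_eq_one_of_norm_mul_sub_eq_one (he _ _) (he _ _)
    (norm_mul_lt_one_left h01 (he _ _)) hd
  have hval : g 0 0 = h 0 0 * (h⁻¹ * g) 0 0 + h 0 1 * (h⁻¹ * g) 1 0 := by
    conv_lhs => rw [show g = h * (h⁻¹ * g) by group]
    rw [Units.val_mul, Matrix.mul_apply, Fin.sum_univ_two]
  have : ‖h 0 0 * (h⁻¹ * g) 0 0‖ < 1 := by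
    rw [eq_sub_of_add_eq hval.symm]
    exact norm_sub_lt_one hg (norm_mul_lt_one_left h01 (hki _ _))
  rw [norm_mul, h00, hk00] at this
  norm_num at this

lemma forall_not_K1mem_iff_norm_lt_one {g : GL (Fin 2) ℚ_[ℓ]} (hg : IsIntegralGL ℓ g) :
    (∀ x : GL (Fin 2) ℚ_[ℓ], (tKmem ℓ x ∧ Kmem ℓ x) →
      ¬ tK1mem ℓ (x⁻¹ * (tGL ℓ * g * (tGL ℓ)⁻¹))) ↔ ‖g 0 0‖ < 1 := by
  constructor
  · intro h
    by_contra hlt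
    obtain ⟨k, hk, hk01, hk1⟩ :=
      exists_K1mem_inv_mul hg (le_antisymm (hg.1 0 0) (not_lt.1 hlt))
    exact h _ ⟨(tGL_conj_mem_tK_iff k).2 hk, (tGL_conj_mem_K_iff k hk).2 hk01⟩
      ((tGL_conj_inv_mul_mem_tK1_iff k g).2 hk1)
  · rintro h x ⟨hx, hxK⟩
    obtain ⟨k, rfl⟩ := exists_eq_tGL_conj x
    rw [tGL_conj_mem_tK_iff] at hx
    rw [tGL_conj_inv_mul_mem_tK1_iff]
    exact not_K1mem_inv_mul_of_norm_lt_one h hx ((tGL_conj_mem_K_iff k hx).1 hxK)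

lemma norm_lt_one_iff_exists_antidiagonal {g : GL (Fin 2) ℚ_[ℓ]} (hg : IsIntegralGL ℓ g) :
    ‖g 0 0‖ < 1 ↔ ∃ (w : ℚ_[ℓ]) (m : GL (Fin 2) ℚ_[ℓ]), ‖w‖ = 1 ∧
      (m : Matrix (Fin 2) (Fin 2) ℚ_[ℓ]) = !![0, w; 1, 0] ∧ K1mem ℓ (m⁻¹ * g) := by
  constructor
  · intro h
    obtain ⟨he, hd⟩ := (isIntegralGL_iff_det g).1 hg
    have h01 : ‖g 0 1‖ = 1 := norm_eq_one_of_norm_mul_sub_eq_one (he _ _) (he 1 0)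
      (norm_mul_lt_one_left h (he 1 1)) (by rw [norm_sub_rev, hd])
    have hne : g 0 1 ≠ 0 := norm_ne_zero_iff.1 (by rw [h01]; exact one_ne_zero)
    let m : GL (Fin 2) ℚ_[ℓ] :=
      Matrix.GeneralLinearGroup.mkOfDetNeZero !![0, g 0 1; 1, 0] (by simpa using hne)
    have hm : (m : Matrix (Fin 2) (Fin 2) ℚ_[ℓ]) = !![0, g 0 1; 1, 0] := rfl
    refine ⟨g 0 1, m, h01, hm, (K1mem_iff _).2
      ⟨(isIntegralGL_antidiagonal h01 hm).inv.mul hg, ?_, ?_⟩⟩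
    · simpa [antidiagonal_inv_mul_val hne hm, h01] using h
    · simp [antidiagonal_inv_mul_val hne hm, hne]
  · rintro ⟨w, m, hw, hm, hk⟩
    have hne : w ≠ 0 := norm_ne_zero_iff.1 (by rw [hw]; exact one_ne_zero)
    simpa [antidiagonal_inv_mul_val hne hm, hw] using ((K1mem_iff _).1 hk).2.1

lemma K1mem_antidiagonal_inv_mul_iff {w w' : ℚ_[ℓ]} (hw : ‖w‖ = 1) (hw' : ‖w'‖ = 1)
    {m m' : GL (Fin 2) ℚ_[ℓ]} (hm : (m : Matrix (Fin 2) (Fin 2) ℚ_[ℓ]) = !![0, w; 1, 0])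
    (hm' : (m' : Matrix (Fin 2) (Fin 2) ℚ_[ℓ]) = !![0, w'; 1, 0]) :
    K1mem ℓ (m⁻¹ * m') ↔ ‖w - w'‖ ≤ (ℓ : ℝ)⁻¹ := by
  have hne : w ≠ 0 := norm_ne_zero_iff.1 (by rw [hw]; exact one_ne_zero)
  have hint : IsIntegralGL ℓ (m⁻¹ * m') :=
    (isIntegralGL_antidiagonal hw hm).inv.mul (isIntegralGL_antidiagonal hw' hm')
  have h11 : ‖w' / w - 1‖ = ‖w - w'‖ := by
    rw [div_sub_one hne, norm_div, hw, div_one, norm_sub_rev]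
  rw [K1mem_iff, norm_le_inv_iff_lt_one, antidiagonal_inv_mul_val hne hm, hm']
  simp [hint, h11]

end Cosets

theorem quotient_map_injective_not_surjective :
    -- the induced map (tKt⁻¹ ∩ K)/(tK₁t⁻¹ ∩ K₁) → (tKt⁻¹)/(tK₁t⁻¹) is injective:
    (∀ x y : GL (Fin 2) ℚ_[ℓ], (tKmem ℓ x ∧ Kmem ℓ x) → (tKmem ℓ y ∧ Kmem ℓ y) →
        tK1mem ℓ (x⁻¹ * y) → (tK1mem ℓ (x⁻¹ * y) ∧ K1mem ℓ (x⁻¹ * y))) ∧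
    -- it is not surjective:
    (∃ z : GL (Fin 2) ℚ_[ℓ], tKmem ℓ z ∧
        ∀ x : GL (Fin 2) ℚ_[ℓ], (tKmem ℓ x ∧ Kmem ℓ x) → ¬ tK1mem ℓ (x⁻¹ * z)) ∧
    -- the cosets of tK₁(ℓ)t⁻¹ in tKt⁻¹ not meeting tKt⁻¹ ∩ K are exactly those of
    -- the elements t·(0,ũ;1,0)·t⁻¹ with ũ ∈ ℤ_ℓˣ (lifting u ∈ (ℤ/ℓℤ)ˣ):
    (∀ z : GL (Fin 2) ℚ_[ℓ], tKmem ℓ z →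
      ((∀ x : GL (Fin 2) ℚ_[ℓ], (tKmem ℓ x ∧ Kmem ℓ x) → ¬ tK1mem ℓ (x⁻¹ * z)) ↔
        ∃ (w : ℚ_[ℓ]) (mw : GL (Fin 2) ℚ_[ℓ]), ‖w‖ = 1 ∧
          (mw : Matrix (Fin 2) (Fin 2) ℚ_[ℓ]) = !![0, w; 1, 0] ∧
          tK1mem ℓ ((tGL ℓ * mw * (tGL ℓ)⁻¹)⁻¹ * z))) ∧
    -- these ℓ - 1 cosets are pairwise distinct, and each is well defined,
    -- i.e. depends only on the class of the lift ũ modulo ℓ: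
    (∀ (w w' : ℚ_[ℓ]), ‖w‖ = 1 → ‖w'‖ = 1 →
      ∀ mw mw' : GL (Fin 2) ℚ_[ℓ],
        (mw : Matrix (Fin 2) (Fin 2) ℚ_[ℓ]) = !![0, w; 1, 0] →
        (mw' : Matrix (Fin 2) (Fin 2) ℚ_[ℓ]) = !![0, w'; 1, 0] →
        (tK1mem ℓ ((tGL ℓ * mw * (tGL ℓ)⁻¹)⁻¹ * (tGL ℓ * mw' * (tGL ℓ)⁻¹)) ↔
          ‖w - w'‖ ≤ (ℓ : ℝ)⁻¹)) := by
  refine ⟨?_, ?_, ?_, ?_⟩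
  · rintro x y ⟨-, hx⟩ ⟨-, hy⟩ h
    refine ⟨h, ?_⟩
    have hK : Kmem ℓ (x⁻¹ * y) := IsIntegralGL.mul (IsIntegralGL.inv hx) hy
    have hconj : x⁻¹ * y = tGL ℓ * ((tGL ℓ)⁻¹ * (x⁻¹ * y) * tGL ℓ) * (tGL ℓ)⁻¹ := by group
    rw [hconj] at hK ⊢
    exact K1mem_tGL_conj h hK
  · let m : GL (Fin 2) ℚ_[ℓ] :=
      Matrix.GeneralLinearGroup.mkOfDetNeZero !![0, 1; 1, 0] (by simp)
    have hm : (m : Matrix (Fin 2) (Fin 2) ℚ_[ℓ]) = !![0, 1; 1, 0] := rfl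
    have hint := isIntegralGL_antidiagonal norm_one hm
    exact ⟨tGL ℓ * m * (tGL ℓ)⁻¹, (tGL_conj_mem_tK_iff m).2 hint,
      (forall_not_K1mem_iff_norm_lt_one hint).2 (by simp [hm])⟩
  · intro z hz
    obtain ⟨g, rfl⟩ := exists_eq_tGL_conj z
    rw [tGL_conj_mem_tK_iff] at hz
    rw [forall_not_K1mem_iff_norm_lt_one hz, norm_lt_one_iff_exists_antidiagonal hz]
    simp only [tGL_conj_inv_mul_mem_tK1_iff]
  · intro w w' hw hw' m m' hm hm'
    rw [tGL_conj_inv_mul_mem_tK1_iff, K1mem_antidiagonal_inv_mul_iff hw hw' hm hm']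

end
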